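/- For every integer k ≥ 0 and every z with 0 < z < 1, one has Σ_{n=1}^{∞} ((k+1)_n/(n·(1/2)_n)) z^n = (2√z · arcsin(√z)/√(1−z)) · Σ_{ℓ=0}^{k} ((1/2)_ℓ/ℓ!) (1−z)^{−ℓ} + Σ_{ℓ=1}^{k} (1/ℓ)( (k+3/2−ℓ)_ℓ/((k+1−ℓ)_ℓ) − (1/2)_ℓ/ℓ! ) (1−z)^{−ℓ} − H_k, where H_k = Σ_{ℓ=1}^{k} 1/ℓ. -/

import Mathlib

open Finset Real

/-- The Pochhammer symbol `(x)_n = x (x+1) ⋯ (x+n-1)`. -/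
noncomputable def poch (x : ℝ) (n : ℕ) : ℝ := (ascPochhammer ℝ n).eval x

theorem poch_zero (x : ℝ) : poch x 0 = 1 := by simp [poch]

theorem poch_succ (x : ℝ) (n : ℕ) : poch x (n + 1) = poch x n * (x + n) :=
  ascPochhammer_succ_eval n x

theorem poch_succ_left (x : ℝ) (n : ℕ) : poch x (n + 1) = x * poch (x + 1) n := by
  simp [poch, ascPochhammer_succ_left, Polynomial.eval_comp]

theorem poch_pos {x : ℝ} (hx : 0 < x) (n : ℕ) : 0 < poch x n :=
  ascPochhammer_pos n x hx

theorem poch_one (n : ℕ) : poch 1 n = n.factorial := by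
  simp [poch]

theorem poch_add_one_div {x : ℝ} (hx : 0 < x) (n : ℕ) :
    poch (x + 1) n = poch x n * (x + n) / x := by
  rw [eq_div_iff hx.ne', mul_comm, ← poch_succ_left, poch_succ]

/-- The integral `∫ sin ^ (2n+1)` over `[0, π]` as a quotient of Pochhammer symbols. -/
theorem integral_sin_pow_odd_eq_poch (n : ℕ) :
    ∫ x in (0 : ℝ)..π, sin x ^ (2 * n + 1) =
      poch 1 (n + 1) / (((n : ℝ) + 1) * poch (1 / 2) (n + 1)) := by
  rw [integral_sin_pow_odd]
  induction n with
  | zero => norm_num [poch_succ, poch_zero]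
  | succ n ih =>
    rw [prod_range_succ, ← mul_assoc, ih, poch_succ 1 (n + 1), poch_succ (1 / 2) (n + 1)]
    have := (poch_pos (x := 1 / 2) (by norm_num) (n + 1)).ne'
    push_cast
    have h1 : (2 * (n : ℝ) + 3) ≠ 0 := by positivity
    have h2 : (1 / 2 + ((n : ℝ) + 1)) ≠ 0 := by positivity
    field_simp
    ring

theorem one_sub_mul_sin_sq_pos {z : ℝ} (h0 : 0 < z) (h1 : z < 1) (x : ℝ) :
    0 < 1 - z * sin x ^ 2 := by
  nlinarith [sin_sq_le_one x]

theorem integral_sin_div_one_sub_mul_sin_sq {z : ℝ} (h0 : 0 < z) (h1 : z < 1) :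
    ∫ x in (0 : ℝ)..π, z * sin x / (1 - z * sin x ^ 2) =
      2 * √z * arcsin √z / √(1 - z) := by
  have hw : 0 < 1 - z := by linarith
  have hs : 0 < √z := sqrt_pos.2 h0
  have hc : 0 < √(1 - z) := sqrt_pos.2 hw
  have hs2 : √z ^ 2 = z := sq_sqrt h0.le
  have hc2 : √(1 - z) ^ 2 = 1 - z := sq_sqrt hw.le
  have harc : arcsin √z = arctan (√z / √(1 - z)) := by
    rw [arcsin_eq_arctan ⟨by linarith, ?_⟩, hs2]
    rw [sqrt_lt' one_pos]; simpa using h1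
  have hder : ∀ x : ℝ, HasDerivAt
      (fun x => -(√z / √(1 - z)) * arctan (√z / √(1 - z) * cos x))
      (z * sin x / (1 - z * sin x ^ 2)) x := by
    intro x
    refine ((((hasDerivAt_cos x).const_mul (√z / √(1 - z))).arctan).const_mul
      (-(√z / √(1 - z)))).congr_deriv ?_
    have hp := one_sub_mul_sin_sq_pos h0 h1 x
    have hq : 1 + (√z / √(1 - z) * cos x) ^ 2 = (1 - z * sin x ^ 2) / (1 - z) := by
      rw [mul_pow, div_pow, hs2, hc2, cos_sq']
      field_simp
      ring
    have hr : -(√z / √(1 - z)) * (1 / ((1 - z * sin x ^ 2) / (1 - z)) *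
        (√z / √(1 - z) * -sin x)) =
        √z ^ 2 / √(1 - z) ^ 2 * (1 - z) * sin x / (1 - z * sin x ^ 2) := by
      field_simp
    rw [hq, hr, hs2, hc2]
    field_simp
  have hcont : Continuous fun x : ℝ => z * sin x / (1 - z * sin x ^ 2) :=
    Continuous.div (by fun_prop) (by fun_prop)
      fun x => (one_sub_mul_sin_sq_pos h0 h1 x).ne'
  rw [intervalIntegral.integral_eq_sub_of_hasDerivAt (fun x _ => hder x)
    (hcont.intervalIntegrable _ _), harc]
  simp only [cos_pi, cos_zero, mul_neg, mul_one, arctan_neg]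
  ring

theorem hasSum_poch_one_div {z : ℝ} (h0 : 0 < z) (h1 : z < 1) :
    HasSum
      (fun n : ℕ => poch 1 (n + 1) / (((n : ℝ) + 1) * poch (1 / 2) (n + 1)) * z ^ (n + 1))
      (2 * √z * arcsin √z / √(1 - z)) := by
  have key := intervalIntegral.hasSum_integral_of_dominated_convergence
    (μ := MeasureTheory.volume) (a := 0) (b := π)
    (F := fun (n : ℕ) x => z ^ (n + 1) * sin x ^ (2 * n + 1))
    (f := fun x => z * sin x / (1 - z * sin x ^ 2)) (fun n _ => z ^ (n + 1))
    (fun n => (by fun_prop : Continuous _).aestronglyMeasurable)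
    (fun n => .of_forall fun x _ => ?_)
    (.of_forall fun x _ => (summable_nat_add_iff 1).2 (summable_geometric_of_lt_one h0.le h1))
    intervalIntegrable_const
    (.of_forall fun x _ => ?_)
  · rw [integral_sin_div_one_sub_mul_sin_sq h0 h1] at key
    refine key.congr_fun fun n => ?_
    rw [intervalIntegral.integral_const_mul, integral_sin_pow_odd_eq_poch, mul_comm]
  · rw [norm_mul, norm_pow, norm_pow, norm_of_nonneg h0.le]
    exact mul_le_of_le_one_right (by positivity)
      (pow_le_one₀ (norm_nonneg _) (abs_sin_le_one x))
  · have hg : HasSum (fun n : ℕ => (z * sin x ^ 2) ^ n) (1 - z * sin x ^ 2)⁻¹ :=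
      hasSum_geometric_of_lt_one (by positivity)
        (by linarith [one_sub_mul_sin_sq_pos h0 h1 x])
    refine (hg.mul_left (z * sin x)).congr_fun fun n => ?_
    rw [mul_pow]
    ring

/-- The terms of the hypergeometric series `₂F₁(1, k + 1; 1 / 2; z)`. -/
noncomputable def hypTerm (z : ℝ) (k n : ℕ) : ℝ :=
  poch ((k : ℝ) + 1) n / poch (1 / 2) n * z ^ n

theorem hypTerm_zero (z : ℝ) (k : ℕ) : hypTerm z k 0 = 1 := by
  simp [hypTerm, poch_zero]

theorem hypTerm_pos {z : ℝ} (h0 : 0 < z) (k n : ℕ) : 0 < hypTerm z k n := by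
  have := poch_pos (x := (k : ℝ) + 1) (by positivity) n
  have := poch_pos (x := 1 / 2) (by norm_num) n
  unfold hypTerm
  positivity

theorem hypTerm_succ (z : ℝ) (k n : ℕ) :
    hypTerm z k (n + 1) = hypTerm z k n * (z * (((k : ℝ) + 1 + n) / (1 / 2 + n))) := by
  simp only [hypTerm, poch_succ, pow_succ, div_eq_mul_inv, mul_inv]
  ring

theorem summable_hypTerm {z : ℝ} (h0 : 0 < z) (h1 : z < 1) (k : ℕ) :
    Summable (hypTerm z k) := by
  refine summable_of_ratio_test_tendsto_lt_one h1
    (.of_forall fun n => (hypTerm_pos h0 k n).ne') ?_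
  have hlim : Filter.Tendsto (fun n : ℕ => z * (1 + ((k : ℝ) + 1 / 2) / ((n : ℝ) + 1 / 2)))
      Filter.atTop (nhds (z * (1 + 0))) :=
    ((Filter.Tendsto.const_div_atTop
      (Filter.tendsto_atTop_add_const_right _ _ tendsto_natCast_atTop_atTop) _).const_add
        _).const_mul _
  rw [add_zero, mul_one] at hlim
  refine hlim.congr fun n => ?_
  rw [norm_of_nonneg (hypTerm_pos h0 k n).le, norm_of_nonneg (hypTerm_pos h0 k _).le,
    hypTerm_succ, mul_div_cancel_left₀ _ (hypTerm_pos h0 k n).ne']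
  congr 1
  field_simp
  ring

theorem hypTerm_succ_left (z : ℝ) (k n : ℕ) :
    hypTerm z (k + 1) n = hypTerm z k n * (((k : ℝ) + 1 + n) / (k + 1)) := by
  simp only [hypTerm]
  push_cast
  rw [poch_add_one_div (by positivity)]
  ring

theorem tsum_hypTerm_succ {z : ℝ} (h0 : 0 < z) (h1 : z < 1) (k : ℕ) :
    ((k : ℝ) + 1) * (1 - z) * ∑' n, hypTerm z (k + 1) n =
      ((k : ℝ) + 3 / 2) * ∑' n, hypTerm z k n - 1 / 2 := by
  have hs := (summable_hypTerm h0 h1 (k + 1)).hasSum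
  have ht := (summable_hypTerm h0 h1 k).hasSum
  have hs' := (hasSum_nat_add_iff' 1).2 hs
  have ht' := ((hasSum_nat_add_iff' 1).2 ht).mul_left ((k : ℝ) + 3 / 2)
  have hd := (hs'.sub (hs.mul_left z)).mul_left ((k : ℝ) + 1)
  have := hd.unique (ht'.congr_fun fun n => ?_)
  · simp only [sum_range_one, hypTerm_zero] at this
    linarith
  · rw [hypTerm_succ_left, hypTerm_succ_left, hypTerm_succ]
    push_cast
    field_simp
    ring

theorem tsum_hypTerm_zero {z : ℝ} (h0 : 0 < z) (h1 : z < 1) :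
    (1 - z) * ∑' n, hypTerm z 0 n = 1 + 2 * √z * arcsin √z / √(1 - z) / 2 := by
  have hs := (summable_hypTerm h0 h1 0).hasSum
  have hd := ((hasSum_nat_add_iff' 1).2 hs).sub (hs.mul_left z)
  have := hd.unique (((hasSum_poch_one_div h0 h1).div_const 2).congr_fun fun n => ?_)
  · simp only [sum_range_one, hypTerm_zero] at this
    linarith
  · have := (poch_pos (x := 1 / 2) (by norm_num) n).ne'
    simp only [hypTerm, poch_succ, Nat.cast_zero, zero_add]
    field_simp
    ring

/-- The quotient `(k + 3/2 - ℓ)_ℓ / (k + 1 - ℓ)_ℓ`. -/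
noncomputable def pochRatio (k ℓ : ℕ) : ℝ :=
  poch ((k : ℝ) + 3 / 2 - ℓ) ℓ / poch ((k : ℝ) + 1 - ℓ) ℓ

theorem pochRatio_succ_succ (k ℓ : ℕ) :
    pochRatio (k + 1) (ℓ + 1) = pochRatio k ℓ * (((k : ℝ) + 3 / 2) / (k + 1)) := by
  have h1 : ((k + 1 : ℕ) : ℝ) + 3 / 2 - ((ℓ + 1 : ℕ) : ℝ) = k + 3 / 2 - ℓ := by push_cast; ring
  have h2 : ((k + 1 : ℕ) : ℝ) + 1 - ((ℓ + 1 : ℕ) : ℝ) = k + 1 - ℓ := by push_cast; ring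
  rw [pochRatio, h1, h2, poch_succ, poch_succ, mul_div_mul_comm, pochRatio]
  congr 2 <;> ring

theorem pochRatio_succ (k ℓ : ℕ) :
    pochRatio k (ℓ + 1) = (((k : ℝ) + 1 / 2 - ℓ) / (k - ℓ)) * pochRatio k ℓ := by
  have h1 : (k : ℝ) + 3 / 2 - ((ℓ + 1 : ℕ) : ℝ) = k + 1 / 2 - ℓ := by push_cast; ring
  have h2 : (k : ℝ) + 1 - ((ℓ + 1 : ℕ) : ℝ) = k - ℓ := by push_cast; ring
  rw [pochRatio, h1, h2, poch_succ_left, poch_succ_left, mul_div_mul_comm, pochRatio]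
  congr 3 <;> ring

theorem pochRatio_self (k : ℕ) :
    pochRatio k k = (2 * k + 1) * (poch (1 / 2) k / k.factorial) := by
  have h1 : (k : ℝ) + 3 / 2 - k = 1 / 2 + 1 := by ring
  have h2 : (k : ℝ) + 1 - k = 1 := by ring
  rw [pochRatio, h1, h2, poch_add_one_div (by norm_num), poch_one]
  ring

theorem tsum_hypTerm {z : ℝ} (h0 : 0 < z) (h1 : z < 1) (k : ℕ) :
    ∑' n, hypTerm z k n =
      (2 * √z * arcsin √z / √(1 - z) + 2) * (k + 1) *
          (poch (1 / 2) (k + 1) / (k + 1).factorial) * (1 - z)⁻¹ ^ (k + 1) -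
        1 / 2 * ∑ ℓ ∈ range k, pochRatio k ℓ / (k - ℓ) * (1 - z)⁻¹ ^ (ℓ + 1) := by
  have hw : 1 - z ≠ 0 := by linarith
  induction k with
  | zero =>
    have h := tsum_hypTerm_zero h0 h1
    rw [mul_comm, ← eq_div_iff hw] at h
    rw [h]
    simp [poch_succ, poch_zero]
    ring
  | succ k ih =>
    have h := tsum_hypTerm_succ h0 h1 k
    have hk : ((k : ℝ) + 1) ≠ 0 := by positivity
    rw [mul_comm, ← eq_div_iff (mul_ne_zero hk hw)] at h
    have hsum : ∑ ℓ ∈ range k,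
        pochRatio (k + 1) (ℓ + 1) / ((k + 1 : ℕ) - (ℓ + 1 : ℕ)) * (1 - z)⁻¹ ^ (ℓ + 1 + 1) =
        ((k : ℝ) + 3 / 2) / (k + 1) * (1 - z)⁻¹ *
          ∑ ℓ ∈ range k, pochRatio k ℓ / (k - ℓ) * (1 - z)⁻¹ ^ (ℓ + 1) := by
      rw [mul_sum]
      refine sum_congr rfl fun ℓ _ => ?_
      rw [pochRatio_succ_succ, pow_succ _ (ℓ + 1)]
      push_cast
      rw [add_sub_add_right_eq_sub]
      ring
    have hzero : pochRatio (k + 1) 0 = 1 := by simp [pochRatio, poch_zero]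
    rw [h, ih, sum_range_succ', hsum, hzero, poch_succ _ (k + 1), Nat.factorial_succ (k + 1),
      pow_succ _ (k + 1)]
    generalize ∑ ℓ ∈ range k, pochRatio k ℓ / (k - ℓ) * (1 - z)⁻¹ ^ (ℓ + 1) = s
    generalize 2 * √z * arcsin √z / √(1 - z) = a
    have hf : ((k + 1).factorial : ℝ) ≠ 0 := by positivity
    have hk2 : ((k : ℝ) + 1 + 1) ≠ 0 := by positivity
    push_cast
    simp only [inv_pow]
    field_simp
    ring

theorem sum_Icc_one_eq_sum_range (f : ℕ → ℝ) (k : ℕ) :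
    ∑ ℓ ∈ Icc 1 k, f ℓ = ∑ ℓ ∈ range k, f (ℓ + 1) := by
  induction k with
  | zero => simp
  | succ k ih => rw [sum_Icc_succ_top (by lia), ih, sum_range_succ]

theorem sum_pochRatio_succ (k : ℕ) (w : ℝ) :
    ∑ ℓ ∈ range (k + 1), 1 / ((ℓ : ℝ) + 1) *
        (pochRatio (k + 1) (ℓ + 1) - poch (1 / 2) (ℓ + 1) / (ℓ + 1).factorial) * w ^ (ℓ + 1) =
      ∑ ℓ ∈ range k, 1 / ((ℓ : ℝ) + 1) *
        (pochRatio k (ℓ + 1) - poch (1 / 2) (ℓ + 1) / (ℓ + 1).factorial) * w ^ (ℓ + 1) +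
      (2 * (poch (1 / 2) (k + 1) / (k + 1).factorial) * w ^ (k + 1) -
        1 / (2 * (k + 1)) * ∑ ℓ ∈ range k, pochRatio k ℓ / (k - ℓ) * w ^ (ℓ + 1)) := by
  have hterm : ∀ ℓ ∈ range k, 1 / ((ℓ : ℝ) + 1) *
        (pochRatio (k + 1) (ℓ + 1) - poch (1 / 2) (ℓ + 1) / (ℓ + 1).factorial) * w ^ (ℓ + 1) =
      1 / ((ℓ : ℝ) + 1) *
        (pochRatio k (ℓ + 1) - poch (1 / 2) (ℓ + 1) / (ℓ + 1).factorial) * w ^ (ℓ + 1) -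
        1 / (2 * (k + 1)) * (pochRatio k ℓ / (k - ℓ) * w ^ (ℓ + 1)) := by
    intro ℓ hℓ
    have hkl : (k : ℝ) - ℓ ≠ 0 :=
      sub_ne_zero.2 (by exact_mod_cast (mem_range.1 hℓ).ne')
    have hdiff : pochRatio (k + 1) (ℓ + 1) = pochRatio k (ℓ + 1) -
        (ℓ + 1) * (1 / (2 * (k + 1)) * (pochRatio k ℓ / (k - ℓ))) := by
      rw [pochRatio_succ_succ, pochRatio_succ]
      field_simp
      ring
    rw [hdiff]
    field_simp
    ring
  rw [sum_range_succ, sum_congr rfl hterm, sum_sub_distrib, ← mul_sum, pochRatio_self]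
  push_cast
  field_simp
  ring

/-- Closed form for `Σ_{n=1}^∞ ((k+1)_n/(n·(1/2)_n)) z^n`, `0 < z < 1`. -/
theorem stmt7 (k : ℕ) (z : ℝ) (h0 : 0 < z) (h1 : z < 1) :
    HasSum
      (fun n : ℕ =>
        poch ((k : ℝ) + 1) (n + 1) / (((n : ℝ) + 1) * poch (1 / 2) (n + 1)) * z ^ (n + 1))
      (2 * Real.sqrt z * Real.arcsin (Real.sqrt z) / Real.sqrt (1 - z) *
          ∑ ℓ ∈ Finset.range (k + 1), poch (1 / 2) ℓ / (ℓ.factorial : ℝ) * (1 - z) ^ (-(ℓ : ℤ))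
        + ∑ ℓ ∈ Finset.Icc 1 k,
            1 / (ℓ : ℝ) *
              (poch ((k : ℝ) + 3 / 2 - ℓ) ℓ / poch ((k : ℝ) + 1 - ℓ) ℓ -
                poch (1 / 2) ℓ / (ℓ.factorial : ℝ)) *
              (1 - z) ^ (-(ℓ : ℤ))
        - ∑ ℓ ∈ Finset.Icc 1 k, 1 / (ℓ : ℝ)) := by
  have hterm : ∀ (j n : ℕ), poch (((j + 1 : ℕ) : ℝ) + 1) (n + 1) /
      (((n : ℝ) + 1) * poch (1 / 2) (n + 1)) * z ^ (n + 1) =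
      poch ((j : ℝ) + 1) (n + 1) / (((n : ℝ) + 1) * poch (1 / 2) (n + 1)) * z ^ (n + 1) +
        1 / ((j : ℝ) + 1) * hypTerm z j (n + 1) := by
    intro j n
    have := (poch_pos (x := 1 / 2) (by norm_num) (n + 1)).ne'
    push_cast
    rw [poch_add_one_div (by positivity), hypTerm]
    push_cast
    field_simp
  simp only [sum_Icc_one_eq_sum_range, zpow_neg, zpow_natCast, ← inv_pow]
  induction k with
  | zero => simpa [poch_zero] using hasSum_poch_one_div h0 h1
  | succ k ih =>
    have hF := (((hasSum_nat_add_iff' 1).2 (summable_hypTerm h0 h1 k).hasSum).mul_left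
      (1 / ((k : ℝ) + 1)))
    rw [sum_range_one, hypTerm_zero, tsum_hypTerm h0 h1] at hF
    convert (ih.add hF).congr_fun fun n => hterm k n using 1
    have hT := sum_pochRatio_succ k (1 - z)⁻¹
    simp only [pochRatio, Nat.cast_add, Nat.cast_one] at hT ⊢
    rw [hT, sum_range_succ _ (k + 1), sum_range_succ (fun ℓ : ℕ => 1 / ((ℓ : ℝ) + 1)) k]
    field_simp
    ring
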